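/- arXiv:1306.6288 — 2 statements merged into one kernel-verified Lean document; each statement's English description precedes it below -/
import Mathlib

section
/- (JSCC converse lemma) In the single-letter JSCC setup, suppose A ⊆ S, δ ≥ 0, and reals R, γ, k satisfy the sphere-packing bound: for every ŝ ∈ Ŝ, P(S ∈ A and d(S, ŝ) ≤ δ) ≤ 2^{−n(R + k)}. Then P(d(S, g(Y)) > δ) ≥ P(i(S,Y) ≤ R − γ) − 2^{−n(γ + k)} − P(S ∉ A). -/
open scoped BigOperators

/-- Probability of an event under a PMF on a finite type. -/
noncomputable def srcPr {S : Type*} [Fintype S] (p : PMF S) (E : Set S) : ℝ :=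
  ∑ s, E.indicator (fun s => (p s).toReal) s

/-- Probability of an event for the joint law `P(s, y) = p(s) · W(e(s))(y)`
of the source and the channel output. -/
noncomputable def jointPr {S X Y : Type*} [Fintype S] [Fintype Y]
    (p : PMF S) (W : X → PMF Y) (e : S → X) (E : Set (S × Y)) : ℝ :=
  ∑ s, ∑ y, E.indicator (fun sy => (p sy.1 * W (e sy.1) sy.2).toReal) (s, y)

/-- The output marginal `q(y) = ∑ s, p(s) · W(e(s))(y)`. -/
noncomputable def outQ {S X Y : Type*} [Fintype S]
    (p : PMF S) (W : X → PMF Y) (e : S → X) (y : Y) : ℝ :=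
  ∑ s, (p s * W (e s) y).toReal

/-- The normalized information density `i(s; y) = (1/n) log₂ (W(e(s))(y) / q(y))`. -/
noncomputable def infoDensity {S X Y : Type*} [Fintype S]
    (n : ℕ) (p : PMF S) (W : X → PMF Y) (e : S → X) (s : S) (y : Y) : ℝ :=
  (1 / (n : ℝ)) * Real.logb 2 ((W (e s) y).toReal / outQ p W e y)

theorem PMF.sum_toReal {α : Type*} [Fintype α] (p : PMF α) : ∑ a, (p a).toReal = 1 := by
  rw [← ENNReal.toReal_sum fun a _ => p.apply_ne_top a, ← tsum_fintype (L := .unconditional α),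
    p.tsum_coe, ENNReal.toReal_one]

theorem sum_outQ {S X Y : Type*} [Fintype S] [Fintype Y]
    (p : PMF S) (W : X → PMF Y) (e : S → X) : ∑ y, outQ p W e y = 1 := by
  simp only [outQ, ENNReal.toReal_mul]
  rw [Finset.sum_comm]
  simp [← Finset.mul_sum, PMF.sum_toReal]

theorem outQ_nonneg {S X Y : Type*} [Fintype S]
    (p : PMF S) (W : X → PMF Y) (e : S → X) (y : Y) : 0 ≤ outQ p W e y :=
  Finset.sum_nonneg fun _ _ => ENNReal.toReal_nonneg

theorem mul_toReal_le_outQ {S X Y : Type*} [Fintype S]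
    (p : PMF S) (W : X → PMF Y) (e : S → X) (s : S) (y : Y) :
    (p s * W (e s) y).toReal ≤ outQ p W e y :=
  Finset.single_le_sum (f := fun s => (p s * W (e s) y).toReal)
    (fun _ _ => ENNReal.toReal_nonneg) (Finset.mem_univ s)

/-- Change of measure: where the information density is at most `t`, the joint law is dominated
by `2 ^ (n t)` times the product of its marginals. -/
theorem mul_toReal_le_of_infoDensity_le {S X Y : Type*} [Fintype S]
    {n : ℕ} (hn : 1 ≤ n) (p : PMF S) (W : X → PMF Y) (e : S → X) {s : S} {y : Y} {t : ℝ}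
    (h : infoDensity n p W e s y ≤ t) :
    (p s * W (e s) y).toReal ≤ (p s).toReal * (2 ^ ((n : ℝ) * t) * outQ p W e y) := by
  have hq := outQ_nonneg p W e y
  rcases (ENNReal.toReal_nonneg (a := p s * W (e s) y)).eq_or_lt with h0 | h0
  · rw [← h0]
    positivity
  have hq0 : 0 < outQ p W e y := h0.trans_le (mul_toReal_le_outQ p W e s y)
  rw [ENNReal.toReal_mul] at h0 ⊢
  have hW : 0 < (W (e s) y).toReal := pos_of_mul_pos_right h0 ENNReal.toReal_nonneg
  gcongr
  have hn' : (0 : ℝ) < n := by exact_mod_cast hn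
  rw [infoDensity, one_div, inv_mul_le_iff₀ hn',
    Real.logb_le_iff_le_rpow one_lt_two (by positivity)] at h
  exact (div_le_iff₀ hq0).mp h

theorem jointPr_preimage_fst {S X Y : Type*} [Fintype S] [Fintype Y]
    (p : PMF S) (W : X → PMF Y) (e : S → X) (E : Set S) :
    jointPr p W e (Prod.fst ⁻¹' E) = srcPr p E := by
  refine Finset.sum_congr rfl fun s _ => ?_
  by_cases hs : s ∈ E <;>
    simp [Set.indicator, hs, ENNReal.toReal_mul, ← Finset.mul_sum, PMF.sum_toReal]

/-- JSCC converse lemma: if the source satisfies the sphere-packing bound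
at distortion level `δ` with rate `R` and slack `k`, then
`P(d(S, g(Y)) > δ) ≥ P(i(S,Y) ≤ R − γ) − 2^{−n(γ+k)} − P(S ∉ A)`. -/
theorem jscc_converse_lemma
    {S X Y Sh : Type*} [Fintype S] [Nonempty S] [Fintype X] [Nonempty X]
    [Fintype Y] [Nonempty Y] [Fintype Sh] [Nonempty Sh]
    (n : ℕ) (hn : 1 ≤ n)
    (p : PMF S) (W : X → PMF Y) (e : S → X) (g : Y → Sh)
    (d : S → Sh → ℝ) (hd : ∀ s sh, 0 ≤ d s sh)
    (A : Set S) (δ : ℝ) (hδ : 0 ≤ δ) (R γ k : ℝ)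
    (hSPO : ∀ sh : Sh, srcPr p {s | s ∈ A ∧ d s sh ≤ δ} ≤ 2 ^ (-(n : ℝ) * (R + k))) :
    jointPr p W e {sy | δ < d sy.1 (g sy.2)} ≥
      jointPr p W e {sy | infoDensity n p W e sy.1 sy.2 ≤ R - γ}
        - 2 ^ (-(n : ℝ) * (γ + k)) - srcPr p Aᶜ := by
  set c : ℝ := 2 ^ ((n : ℝ) * (R - γ))
  have hc : 0 ≤ c := by positivity
  have hsplit : jointPr p W e {sy | infoDensity n p W e sy.1 sy.2 ≤ R - γ} ≤
      jointPr p W e {sy | δ < d sy.1 (g sy.2)} + jointPr p W e (Prod.fst ⁻¹' Aᶜ) +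
        ∑ s, ∑ y, c * outQ p W e y *
          {s | s ∈ A ∧ d s (g y) ≤ δ}.indicator (fun s => (p s).toReal) s := by
    simp only [jointPr, ← Finset.sum_add_distrib]
    refine Finset.sum_le_sum fun s _ => Finset.sum_le_sum fun y _ => ?_
    have hP : 0 ≤ (p s * W (e s) y).toReal := ENNReal.toReal_nonneg
    have hprod : 0 ≤ c * outQ p W e y * (p s).toReal :=
      mul_nonneg (mul_nonneg hc (outQ_nonneg p W e y)) ENNReal.toReal_nonneg
    have hchange : infoDensity n p W e s y ≤ R - γ →
        (p s * W (e s) y).toReal ≤ c * outQ p W e y * (p s).toReal := fun h =>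
      (mul_toReal_le_of_infoDensity_le hn p W e h).trans_eq (mul_comm _ _)
    simp only [Set.indicator, Set.mem_ofPred_eq, Set.mem_preimage, Set.mem_compl_iff, mul_ite,
      mul_zero]
    generalize c * outQ p W e y * (p s).toReal = v at hprod hchange ⊢
    grind
  have hball : ∑ s, ∑ y, c * outQ p W e y *
      {s | s ∈ A ∧ d s (g y) ≤ δ}.indicator (fun s => (p s).toReal) s ≤
        2 ^ (-(n : ℝ) * (γ + k)) := by
    rw [Finset.sum_comm]
    calc _ = ∑ y, c * outQ p W e y * srcPr p {s | s ∈ A ∧ d s (g y) ≤ δ} := by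
          simp only [srcPr, Finset.mul_sum]
      _ ≤ ∑ y, c * outQ p W e y * 2 ^ (-(n : ℝ) * (R + k)) :=
          Finset.sum_le_sum fun y _ =>
            mul_le_mul_of_nonneg_left (hSPO (g y)) (mul_nonneg hc (outQ_nonneg p W e y))
      _ = c * 2 ^ (-(n : ℝ) * (R + k)) := by
          rw [← Finset.sum_mul, ← Finset.mul_sum, sum_outQ, mul_one]
      _ = 2 ^ (-(n : ℝ) * (γ + k)) := by
          rw [← Real.rpow_add two_pos]
          ring_nf
  rw [jointPr_preimage_fst] at hsplit
  linarith
end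

section
/- (JSCC converse lemma, multiple access) In the two-user MAC JSCC setup, suppose A₁ ⊆ S₁, A₂ ⊆ S₂, δ₁, δ₂ ≥ 0, and reals R₁, R₂, γ, k₁, k₂ satisfy: for every ŝ₁ ∈ Ŝ₁, P(S₁ ∈ A₁ and d₁(S₁, ŝ₁) ≤ δ₁) ≤ 2^{−n(R₁ + k₁)}, and for every ŝ₂ ∈ Ŝ₂, P(S₂ ∈ A₂ and d₂(S₂, ŝ₂) ≤ δ₂) ≤ 2^{−n(R₂ + k₂)}. Let T be the event {i₁(S₁,S₂,Y) ≤ R₁ − γ} ∪ {i₂(S₁,S₂,Y) ≤ R₂ − γ} ∪ {i₃(S₁,S₂,Y) ≤ R₁ + R₂ − γ}. Then P(d₁(S₁, g₁(Y)) > δ₁ or d₂(S₂, g₂(Y)) > δ₂) ≥ P(T) − 2^{−n(γ + k₁)} − 2^{−n(γ + k₂)} − 2^{−n(γ + k₁ + k₂)} − P(S₁ ∉ A₁) − P(S₂ ∉ A₂). -/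
open scoped BigOperators

/-- Probability of an event for the joint law
`P(s₁, s₂, y) = p₁(s₁) · p₂(s₂) · W(e₁(s₁), e₂(s₂))(y)` of the two independent
sources and the output of the multiple-access channel. -/
noncomputable def macPr {S₁ S₂ X₁ X₂ Y : Type*} [Fintype S₁] [Fintype S₂] [Fintype Y]
    (p₁ : PMF S₁) (p₂ : PMF S₂) (W : X₁ → X₂ → PMF Y)
    (e₁ : S₁ → X₁) (e₂ : S₂ → X₂) (E : Set (S₁ × S₂ × Y)) : ℝ :=
  ∑ s₁, ∑ s₂, ∑ y,
    E.indicator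
      (fun z => (p₁ z.1 * p₂ z.2.1 * W (e₁ z.1) (e₂ z.2.1) z.2.2).toReal) (s₁, s₂, y)

/-- Conditional output law `q₁(y | s₂) = ∑ s₁, p₁(s₁) · W(e₁(s₁), e₂(s₂))(y)`. -/
noncomputable def macQ₁ {S₁ S₂ X₁ X₂ Y : Type*} [Fintype S₁]
    (p₁ : PMF S₁) (W : X₁ → X₂ → PMF Y) (e₁ : S₁ → X₁) (e₂ : S₂ → X₂)
    (s₂ : S₂) (y : Y) : ℝ :=
  ∑ s₁, (p₁ s₁ * W (e₁ s₁) (e₂ s₂) y).toReal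

/-- Conditional information density
`i₁(s₁, s₂, y) = (1/n) log₂ (W(e₁(s₁), e₂(s₂))(y) / q₁(y|s₂))`. -/
noncomputable def macInfo₁ {S₁ S₂ X₁ X₂ Y : Type*} [Fintype S₁]
    (n : ℕ) (p₁ : PMF S₁) (W : X₁ → X₂ → PMF Y) (e₁ : S₁ → X₁) (e₂ : S₂ → X₂)
    (s₁ : S₁) (s₂ : S₂) (y : Y) : ℝ :=
  (1 / (n : ℝ)) *
    Real.logb 2 ((W (e₁ s₁) (e₂ s₂) y).toReal / macQ₁ p₁ W e₁ e₂ s₂ y)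

/-- Conditional output law `q₂(y | s₁) = ∑ s₂, p₂(s₂) · W(e₁(s₁), e₂(s₂))(y)`. -/
noncomputable def macQ₂ {S₁ S₂ X₁ X₂ Y : Type*} [Fintype S₂]
    (p₂ : PMF S₂) (W : X₁ → X₂ → PMF Y) (e₁ : S₁ → X₁) (e₂ : S₂ → X₂)
    (s₁ : S₁) (y : Y) : ℝ :=
  ∑ s₂, (p₂ s₂ * W (e₁ s₁) (e₂ s₂) y).toReal

/-- Output marginal `q(y) = ∑ s₁ s₂, p₁(s₁) p₂(s₂) · W(e₁(s₁), e₂(s₂))(y)`. -/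
noncomputable def macQ {S₁ S₂ X₁ X₂ Y : Type*} [Fintype S₁] [Fintype S₂]
    (p₁ : PMF S₁) (p₂ : PMF S₂) (W : X₁ → X₂ → PMF Y)
    (e₁ : S₁ → X₁) (e₂ : S₂ → X₂) (y : Y) : ℝ :=
  ∑ s₁, ∑ s₂, (p₁ s₁ * p₂ s₂ * W (e₁ s₁) (e₂ s₂) y).toReal

/-- Conditional information density
`i₂(s₁, s₂, y) = (1/n) log₂ (W(e₁(s₁), e₂(s₂))(y) / q₂(y|s₁))`. -/
noncomputable def macInfo₂ {S₁ S₂ X₁ X₂ Y : Type*} [Fintype S₂]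
    (n : ℕ) (p₂ : PMF S₂) (W : X₁ → X₂ → PMF Y) (e₁ : S₁ → X₁) (e₂ : S₂ → X₂)
    (s₁ : S₁) (s₂ : S₂) (y : Y) : ℝ :=
  (1 / (n : ℝ)) *
    Real.logb 2 ((W (e₁ s₁) (e₂ s₂) y).toReal / macQ₂ p₂ W e₁ e₂ s₁ y)

/-- Information density
`i₃(s₁, s₂, y) = (1/n) log₂ (W(e₁(s₁), e₂(s₂))(y) / q(y))`. -/
noncomputable def macInfo₃ {S₁ S₂ X₁ X₂ Y : Type*} [Fintype S₁] [Fintype S₂]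
    (n : ℕ) (p₁ : PMF S₁) (p₂ : PMF S₂) (W : X₁ → X₂ → PMF Y)
    (e₁ : S₁ → X₁) (e₂ : S₂ → X₂) (s₁ : S₁) (s₂ : S₂) (y : Y) : ℝ :=
  (1 / (n : ℝ)) *
    Real.logb 2 ((W (e₁ s₁) (e₂ s₂) y).toReal / macQ p₁ p₂ W e₁ e₂ y)

theorem PMF.sum_toReal_eq_one {S : Type*} [Fintype S] (p : PMF S) :
    ∑ s, (p s).toReal = 1 := by
  rw [← ENNReal.toReal_sum (fun s _ => p.apply_ne_top s), ← tsum_fintype (L := .unconditional S),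
    p.tsum_coe, ENNReal.toReal_one]

/-- A bound on the information density `(1/n) log₂ (w/q)` bounds `w` by a multiple of `q`. -/
theorem le_mul_rpow_of_logb_div_le {n : ℕ} (hn : 1 ≤ n) {w q r : ℝ} (hw : 0 < w) (hq : 0 < q)
    (h : (1 / (n : ℝ)) * Real.logb 2 (w / q) ≤ r) : w ≤ q * 2 ^ ((n : ℝ) * r) := by
  have hn' : (0 : ℝ) < n := by exact_mod_cast hn
  have h' : Real.logb 2 (w / q) ≤ n * r := by
    rw [one_div, inv_mul_le_iff₀ hn'] at h
    exact h
  rw [Real.logb_le_iff_le_rpow one_lt_two (div_pos hw hq), div_le_iff₀ hq] at h'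
  linarith

section MAC

variable {S₁ S₂ X₁ X₂ Y : Type*} [Fintype S₁] [Fintype S₂] [Fintype Y]
  (p₁ : PMF S₁) (p₂ : PMF S₂) (W : X₁ → X₂ → PMF Y) (e₁ : S₁ → X₁) (e₂ : S₂ → X₂)

theorem macPr_mono {E F : Set (S₁ × S₂ × Y)} (h : E ⊆ F) :
    macPr p₁ p₂ W e₁ e₂ E ≤ macPr p₁ p₂ W e₁ e₂ F :=
  Finset.sum_le_sum fun _ _ => Finset.sum_le_sum fun _ _ => Finset.sum_le_sum fun _ _ =>
    Set.indicator_le_indicator_of_subset h (fun _ => ENNReal.toReal_nonneg) _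

theorem macPr_union_le (E F : Set (S₁ × S₂ × Y)) :
    macPr p₁ p₂ W e₁ e₂ (E ∪ F) ≤ macPr p₁ p₂ W e₁ e₂ E + macPr p₁ p₂ W e₁ e₂ F := by
  simp only [macPr, ← Finset.sum_add_distrib]
  refine Finset.sum_le_sum fun _ _ => Finset.sum_le_sum fun _ _ => Finset.sum_le_sum fun _ _ => ?_
  rw [← Pi.add_apply (Set.indicator E _), ← Set.indicator_union_add_inter]
  exact le_add_of_nonneg_right (Set.indicator_nonneg (fun _ _ => ENNReal.toReal_nonneg) _)

/-- An event has probability at most the total of any nonnegative function that dominates the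
joint law at the points of positive mass in the event. -/
theorem macPr_le_sum {E : Set (S₁ × S₂ × Y)} (f : S₁ → S₂ → Y → ℝ)
    (hf : ∀ s₁ s₂ y, 0 ≤ f s₁ s₂ y)
    (h : ∀ s₁ s₂ y, (s₁, s₂, y) ∈ E → 0 < (p₁ s₁).toReal → 0 < (p₂ s₂).toReal →
      0 < (W (e₁ s₁) (e₂ s₂) y).toReal →
      (p₁ s₁).toReal * (p₂ s₂).toReal * (W (e₁ s₁) (e₂ s₂) y).toReal ≤ f s₁ s₂ y) :
    macPr p₁ p₂ W e₁ e₂ E ≤ ∑ s₁, ∑ s₂, ∑ y, f s₁ s₂ y := by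
  refine Finset.sum_le_sum fun s₁ _ => Finset.sum_le_sum fun s₂ _ =>
    Finset.sum_le_sum fun y _ => ?_
  refine Set.indicator_apply_le' (fun hE => ?_) (fun _ => hf s₁ s₂ y)
  simp only [ENNReal.toReal_mul]
  rcases (ENNReal.toReal_nonneg (a := p₁ s₁)).eq_or_lt with h₁ | h₁
  · simpa [← h₁] using hf s₁ s₂ y
  rcases (ENNReal.toReal_nonneg (a := p₂ s₂)).eq_or_lt with h₂ | h₂
  · simpa [← h₂] using hf s₁ s₂ y
  rcases (ENNReal.toReal_nonneg (a := W (e₁ s₁) (e₂ s₂) y)).eq_or_lt with h₃ | h₃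
  · simpa [← h₃] using hf s₁ s₂ y
  exact h s₁ s₂ y hE h₁ h₂ h₃

theorem macPr_fst_le (E : Set S₁) : macPr p₁ p₂ W e₁ e₂ {z | z.1 ∈ E} ≤ srcPr p₁ E := by
  refine (macPr_le_sum p₁ p₂ W e₁ e₂ (fun s₁ s₂ y => E.indicator (fun s => (p₁ s).toReal) s₁ *
    (p₂ s₂).toReal * (W (e₁ s₁) (e₂ s₂) y).toReal) ?_ ?_).trans_eq ?_
  · intro s₁ s₂ y
    have := Set.indicator_nonneg (s := E) (f := fun s => (p₁ s).toReal)
      (fun _ _ => ENNReal.toReal_nonneg) s₁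
    positivity
  · intro s₁ s₂ y hE _ _ _
    rw [Set.indicator_of_mem (show s₁ ∈ E from hE)]
  · simp [← Finset.mul_sum, PMF.sum_toReal_eq_one, srcPr]

theorem macPr_snd_le (E : Set S₂) : macPr p₁ p₂ W e₁ e₂ {z | z.2.1 ∈ E} ≤ srcPr p₂ E := by
  refine (macPr_le_sum p₁ p₂ W e₁ e₂ (fun s₁ s₂ y => (p₁ s₁).toReal *
    E.indicator (fun s => (p₂ s).toReal) s₂ * (W (e₁ s₁) (e₂ s₂) y).toReal) ?_ ?_).trans_eq ?_
  · intro s₁ s₂ y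
    have := Set.indicator_nonneg (s := E) (f := fun s => (p₂ s).toReal)
      (fun _ _ => ENNReal.toReal_nonneg) s₂
    positivity
  · intro s₁ s₂ y hE _ _ _
    rw [Set.indicator_of_mem (show s₂ ∈ E from hE)]
  · simp [← Finset.mul_sum, ← Finset.sum_mul, PMF.sum_toReal_eq_one, srcPr]

omit [Fintype S₂] [Fintype Y] in
theorem macQ₁_nonneg (s₂ : S₂) (y : Y) : 0 ≤ macQ₁ p₁ W e₁ e₂ s₂ y :=
  Finset.sum_nonneg fun _ _ => ENNReal.toReal_nonneg

omit [Fintype S₁] [Fintype Y] in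
theorem macQ₂_nonneg (s₁ : S₁) (y : Y) : 0 ≤ macQ₂ p₂ W e₁ e₂ s₁ y :=
  Finset.sum_nonneg fun _ _ => ENNReal.toReal_nonneg

omit [Fintype Y] in
theorem macQ_nonneg (y : Y) : 0 ≤ macQ p₁ p₂ W e₁ e₂ y :=
  Finset.sum_nonneg fun _ _ => Finset.sum_nonneg fun _ _ => ENNReal.toReal_nonneg

omit [Fintype S₂] [Fintype Y] in
theorem macQ₁_pos {s₁ : S₁} {s₂ : S₂} {y : Y} (h₁ : 0 < (p₁ s₁).toReal)
    (hw : 0 < (W (e₁ s₁) (e₂ s₂) y).toReal) : 0 < macQ₁ p₁ W e₁ e₂ s₂ y :=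
  Finset.sum_pos' (fun _ _ => ENNReal.toReal_nonneg)
    ⟨s₁, Finset.mem_univ _, by rw [ENNReal.toReal_mul]; positivity⟩

omit [Fintype S₁] [Fintype Y] in
theorem macQ₂_pos {s₁ : S₁} {s₂ : S₂} {y : Y} (h₂ : 0 < (p₂ s₂).toReal)
    (hw : 0 < (W (e₁ s₁) (e₂ s₂) y).toReal) : 0 < macQ₂ p₂ W e₁ e₂ s₁ y :=
  Finset.sum_pos' (fun _ _ => ENNReal.toReal_nonneg)
    ⟨s₂, Finset.mem_univ _, by rw [ENNReal.toReal_mul]; positivity⟩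

omit [Fintype Y] in
theorem macQ_pos {s₁ : S₁} {s₂ : S₂} {y : Y} (h₁ : 0 < (p₁ s₁).toReal)
    (h₂ : 0 < (p₂ s₂).toReal) (hw : 0 < (W (e₁ s₁) (e₂ s₂) y).toReal) :
    0 < macQ p₁ p₂ W e₁ e₂ y :=
  Finset.sum_pos' (fun _ _ => Finset.sum_nonneg fun _ _ => ENNReal.toReal_nonneg)
    ⟨s₁, Finset.mem_univ _, Finset.sum_pos' (fun _ _ => ENNReal.toReal_nonneg)
      ⟨s₂, Finset.mem_univ _, by simp only [ENNReal.toReal_mul]; positivity⟩⟩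

omit [Fintype S₂] in
theorem sum_macQ₁ (s₂ : S₂) : ∑ y, macQ₁ p₁ W e₁ e₂ s₂ y = 1 := by
  simp only [macQ₁, ENNReal.toReal_mul]
  rw [Finset.sum_comm]
  simp [← Finset.mul_sum, PMF.sum_toReal_eq_one]

omit [Fintype S₁] in
theorem sum_macQ₂ (s₁ : S₁) : ∑ y, macQ₂ p₂ W e₁ e₂ s₁ y = 1 := by
  simp only [macQ₂, ENNReal.toReal_mul]
  rw [Finset.sum_comm]
  simp [← Finset.mul_sum, PMF.sum_toReal_eq_one]

theorem sum_macQ : ∑ y, macQ p₁ p₂ W e₁ e₂ y = 1 := by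
  simp only [macQ, ENNReal.toReal_mul]
  rw [Finset.sum_comm]
  simp_rw [Finset.sum_comm (s := (Finset.univ : Finset Y))]
  simp [← Finset.mul_sum, PMF.sum_toReal_eq_one]

/-- If `s₁` lies in a set of small source probability chosen from `y`, and the first conditional
information density is at most `r`, the joint probability is small. -/
theorem macPr_macInfo₁_le {n : ℕ} (hn : 1 ≤ n) (F : Y → Set S₁) {r ε : ℝ}
    (hF : ∀ y, srcPr p₁ (F y) ≤ ε) :
    macPr p₁ p₂ W e₁ e₂ {z | macInfo₁ n p₁ W e₁ e₂ z.1 z.2.1 z.2.2 ≤ r ∧ z.1 ∈ F z.2.2} ≤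
      2 ^ ((n : ℝ) * r) * ε := by
  have hind : ∀ y s, 0 ≤ (F y).indicator (fun s => (p₁ s).toReal) s := fun y s =>
    Set.indicator_nonneg (fun _ _ => ENNReal.toReal_nonneg) s
  have hq := macQ₁_nonneg p₁ W e₁ e₂
  refine (macPr_le_sum p₁ p₂ W e₁ e₂ (fun s₁ s₂ y => (p₂ s₂).toReal * macQ₁ p₁ W e₁ e₂ s₂ y *
    2 ^ ((n : ℝ) * r) * (F y).indicator (fun s => (p₁ s).toReal) s₁) ?_ ?_).trans ?_
  · intro s₁ s₂ y
    have h₁ := hind y s₁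
    have h₂ := hq s₂ y
    positivity
  · rintro s₁ s₂ y ⟨hi, hs⟩ h₁ h₂ h₃
    have h := le_mul_rpow_of_logb_div_le hn h₃ (macQ₁_pos p₁ W e₁ e₂ h₁ h₃) hi
    rw [Set.indicator_of_mem (show s₁ ∈ F y from hs)]
    calc _ ≤ _ := mul_le_mul_of_nonneg_left h (mul_pos h₁ h₂).le
      _ = _ := by ring
  · rw [Finset.sum_comm]
    simp_rw [Finset.sum_comm (s := (Finset.univ : Finset S₁)), ← Finset.mul_sum]
    calc _ ≤ ∑ s₂, ∑ y, (p₂ s₂).toReal * macQ₁ p₁ W e₁ e₂ s₂ y * 2 ^ ((n : ℝ) * r) * ε :=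
          Finset.sum_le_sum fun s₂ _ => Finset.sum_le_sum fun y _ =>
            mul_le_mul_of_nonneg_left (hF y) (by have := hq s₂ y; positivity)
      _ = _ := by
          simp [← Finset.sum_mul, ← Finset.mul_sum, sum_macQ₁, PMF.sum_toReal_eq_one]

/-- If `s₂` lies in a set of small source probability chosen from `y`, and the second conditional
information density is at most `r`, the joint probability is small. -/
theorem macPr_macInfo₂_le {n : ℕ} (hn : 1 ≤ n) (F : Y → Set S₂) {r ε : ℝ}
    (hF : ∀ y, srcPr p₂ (F y) ≤ ε) :
    macPr p₁ p₂ W e₁ e₂ {z | macInfo₂ n p₂ W e₁ e₂ z.1 z.2.1 z.2.2 ≤ r ∧ z.2.1 ∈ F z.2.2} ≤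
      2 ^ ((n : ℝ) * r) * ε := by
  have hind : ∀ y s, 0 ≤ (F y).indicator (fun s => (p₂ s).toReal) s := fun y s =>
    Set.indicator_nonneg (fun _ _ => ENNReal.toReal_nonneg) s
  have hq := macQ₂_nonneg p₂ W e₁ e₂
  refine (macPr_le_sum p₁ p₂ W e₁ e₂ (fun s₁ s₂ y => (p₁ s₁).toReal * macQ₂ p₂ W e₁ e₂ s₁ y *
    2 ^ ((n : ℝ) * r) * (F y).indicator (fun s => (p₂ s).toReal) s₂) ?_ ?_).trans ?_
  · intro s₁ s₂ y
    have h₁ := hind y s₂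
    have h₂ := hq s₁ y
    positivity
  · rintro s₁ s₂ y ⟨hi, hs⟩ h₁ h₂ h₃
    have h := le_mul_rpow_of_logb_div_le hn h₃ (macQ₂_pos p₂ W e₁ e₂ h₂ h₃) hi
    rw [Set.indicator_of_mem (show s₂ ∈ F y from hs)]
    calc _ ≤ _ := mul_le_mul_of_nonneg_left h (mul_pos h₁ h₂).le
      _ = _ := by ring
  · simp_rw [Finset.sum_comm (s := (Finset.univ : Finset S₂)), ← Finset.mul_sum]
    calc _ ≤ ∑ s₁, ∑ y, (p₁ s₁).toReal * macQ₂ p₂ W e₁ e₂ s₁ y * 2 ^ ((n : ℝ) * r) * ε :=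
          Finset.sum_le_sum fun s₁ _ => Finset.sum_le_sum fun y _ =>
            mul_le_mul_of_nonneg_left (hF y) (by have := hq s₁ y; positivity)
      _ = _ := by
          simp [← Finset.sum_mul, ← Finset.mul_sum, sum_macQ₂, PMF.sum_toReal_eq_one]

/-- If both sources lie in sets of small probability chosen from `y`, and the joint information
density is at most `r`, the joint probability is small. -/
theorem macPr_macInfo₃_le {n : ℕ} (hn : 1 ≤ n) (F₁ : Y → Set S₁) (F₂ : Y → Set S₂)
    {r ε₁ ε₂ : ℝ} (hε₁ : 0 ≤ ε₁) (hF₁ : ∀ y, srcPr p₁ (F₁ y) ≤ ε₁)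
    (hF₂ : ∀ y, srcPr p₂ (F₂ y) ≤ ε₂) :
    macPr p₁ p₂ W e₁ e₂ {z | macInfo₃ n p₁ p₂ W e₁ e₂ z.1 z.2.1 z.2.2 ≤ r ∧
        z.1 ∈ F₁ z.2.2 ∧ z.2.1 ∈ F₂ z.2.2} ≤
      2 ^ ((n : ℝ) * r) * (ε₁ * ε₂) := by
  have hind₁ : ∀ y s, 0 ≤ (F₁ y).indicator (fun s => (p₁ s).toReal) s := fun y s =>
    Set.indicator_nonneg (fun _ _ => ENNReal.toReal_nonneg) s
  have hind₂ : ∀ y s, 0 ≤ (F₂ y).indicator (fun s => (p₂ s).toReal) s := fun y s =>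
    Set.indicator_nonneg (fun _ _ => ENNReal.toReal_nonneg) s
  have hq := macQ_nonneg p₁ p₂ W e₁ e₂
  refine (macPr_le_sum p₁ p₂ W e₁ e₂ (fun s₁ s₂ y => macQ p₁ p₂ W e₁ e₂ y *
    2 ^ ((n : ℝ) * r) * ((F₁ y).indicator (fun s => (p₁ s).toReal) s₁ *
      (F₂ y).indicator (fun s => (p₂ s).toReal) s₂)) ?_ ?_).trans ?_
  · intro s₁ s₂ y
    have h₁ := hind₁ y s₁
    have h₂ := hind₂ y s₂
    have h₃ := hq y
    positivity
  · rintro s₁ s₂ y ⟨hi, hs₁, hs₂⟩ h₁ h₂ h₃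
    have h := le_mul_rpow_of_logb_div_le hn h₃ (macQ_pos p₁ p₂ W e₁ e₂ h₁ h₂ h₃) hi
    rw [Set.indicator_of_mem (show s₁ ∈ F₁ y from hs₁),
      Set.indicator_of_mem (show s₂ ∈ F₂ y from hs₂)]
    calc _ ≤ _ := mul_le_mul_of_nonneg_left h (mul_pos h₁ h₂).le
      _ = _ := by ring
  · simp_rw [Finset.sum_comm (s := (Finset.univ : Finset S₂)) (t := (Finset.univ : Finset Y))]
    rw [Finset.sum_comm]
    simp_rw [← Finset.mul_sum, ← Finset.sum_mul]
    calc _ ≤ ∑ y, macQ p₁ p₂ W e₁ e₂ y * 2 ^ ((n : ℝ) * r) * (ε₁ * ε₂) :=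
          Finset.sum_le_sum fun y _ => mul_le_mul_of_nonneg_left
            (mul_le_mul (hF₁ y) (hF₂ y) (Finset.sum_nonneg fun s _ => hind₂ y s) hε₁)
            (by have := hq y; positivity)
      _ = _ := by simp [← Finset.sum_mul, sum_macQ]

end MAC

/-- JSCC converse lemma for the two-user multiple access channel: if both (independent)
sources satisfy the sphere-packing bound, then
`P(d₁(S₁,g₁(Y)) > δ₁ ∨ d₂(S₂,g₂(Y)) > δ₂) ≥ P(T) − 2^{−n(γ+k₁)} − 2^{−n(γ+k₂)}
  − 2^{−n(γ+k₁+k₂)} − P(S₁ ∉ A₁) − P(S₂ ∉ A₂)`,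
where `T` is the union of the three information-spectrum events. -/
theorem mac_jscc_converse_lemma
    {S₁ S₂ X₁ X₂ Y Sh₁ Sh₂ : Type*}
    [Fintype S₁] [Nonempty S₁] [Fintype S₂] [Nonempty S₂]
    [Fintype X₁] [Nonempty X₁] [Fintype X₂] [Nonempty X₂]
    [Fintype Y] [Nonempty Y] [Fintype Sh₁] [Nonempty Sh₁] [Fintype Sh₂] [Nonempty Sh₂]
    (n : ℕ) (hn : 1 ≤ n)
    (p₁ : PMF S₁) (p₂ : PMF S₂) (W : X₁ → X₂ → PMF Y)
    (e₁ : S₁ → X₁) (e₂ : S₂ → X₂) (g₁ : Y → Sh₁) (g₂ : Y → Sh₂)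
    (d₁ : S₁ → Sh₁ → ℝ) (d₂ : S₂ → Sh₂ → ℝ)
    (hd₁ : ∀ s sh, 0 ≤ d₁ s sh) (hd₂ : ∀ s sh, 0 ≤ d₂ s sh)
    (A₁ : Set S₁) (A₂ : Set S₂) (δ₁ δ₂ : ℝ) (hδ₁ : 0 ≤ δ₁) (hδ₂ : 0 ≤ δ₂)
    (R₁ R₂ γ k₁ k₂ : ℝ)
    (hSPO₁ : ∀ sh₁ : Sh₁,
      srcPr p₁ {s₁ | s₁ ∈ A₁ ∧ d₁ s₁ sh₁ ≤ δ₁} ≤ 2 ^ (-(n : ℝ) * (R₁ + k₁)))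
    (hSPO₂ : ∀ sh₂ : Sh₂,
      srcPr p₂ {s₂ | s₂ ∈ A₂ ∧ d₂ s₂ sh₂ ≤ δ₂} ≤ 2 ^ (-(n : ℝ) * (R₂ + k₂))) :
    macPr p₁ p₂ W e₁ e₂
        {z | δ₁ < d₁ z.1 (g₁ z.2.2) ∨ δ₂ < d₂ z.2.1 (g₂ z.2.2)} ≥
      macPr p₁ p₂ W e₁ e₂
        {z | macInfo₁ n p₁ W e₁ e₂ z.1 z.2.1 z.2.2 ≤ R₁ - γ ∨
             macInfo₂ n p₂ W e₁ e₂ z.1 z.2.1 z.2.2 ≤ R₂ - γ ∨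
             macInfo₃ n p₁ p₂ W e₁ e₂ z.1 z.2.1 z.2.2 ≤ R₁ + R₂ - γ}
      - 2 ^ (-(n : ℝ) * (γ + k₁)) - 2 ^ (-(n : ℝ) * (γ + k₂))
      - 2 ^ (-(n : ℝ) * (γ + k₁ + k₂))
      - srcPr p₁ A₁ᶜ - srcPr p₂ A₂ᶜ := by
  have h₁ := macPr_macInfo₁_le p₁ p₂ W e₁ e₂ hn
    (fun y => {s | s ∈ A₁ ∧ d₁ s (g₁ y) ≤ δ₁}) (r := R₁ - γ) (fun y => hSPO₁ (g₁ y))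
  have h₂ := macPr_macInfo₂_le p₁ p₂ W e₁ e₂ hn
    (fun y => {s | s ∈ A₂ ∧ d₂ s (g₂ y) ≤ δ₂}) (r := R₂ - γ) (fun y => hSPO₂ (g₂ y))
  have h₃ := macPr_macInfo₃_le p₁ p₂ W e₁ e₂ hn
    (fun y => {s | s ∈ A₁ ∧ d₁ s (g₁ y) ≤ δ₁}) (fun y => {s | s ∈ A₂ ∧ d₂ s (g₂ y) ≤ δ₂})
    (r := R₁ + R₂ - γ) (by positivity) (fun y => hSPO₁ (g₁ y)) (fun y => hSPO₂ (g₂ y))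
  simp only [← Real.rpow_add two_pos] at h₁ h₂ h₃
  rw [show (n : ℝ) * (R₁ - γ) + -(n : ℝ) * (R₁ + k₁) = -(n : ℝ) * (γ + k₁) by ring] at h₁
  rw [show (n : ℝ) * (R₂ - γ) + -(n : ℝ) * (R₂ + k₂) = -(n : ℝ) * (γ + k₂) by ring] at h₂
  rw [show (n : ℝ) * (R₁ + R₂ - γ) + (-(n : ℝ) * (R₁ + k₁) + -(n : ℝ) * (R₂ + k₂)) =
    -(n : ℝ) * (γ + k₁ + k₂) by ring] at h₃
  have h₄ := macPr_fst_le p₁ p₂ W e₁ e₂ A₁ᶜ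
  have h₅ := macPr_snd_le p₁ p₂ W e₁ e₂ A₂ᶜ
  set P := macPr p₁ p₂ W e₁ e₂
  set T := {z : S₁ × S₂ × Y | macInfo₁ n p₁ W e₁ e₂ z.1 z.2.1 z.2.2 ≤ R₁ - γ ∨
    macInfo₂ n p₂ W e₁ e₂ z.1 z.2.1 z.2.2 ≤ R₂ - γ ∨
    macInfo₃ n p₁ p₂ W e₁ e₂ z.1 z.2.1 z.2.2 ≤ R₁ + R₂ - γ} with hT
  set D := {z : S₁ × S₂ × Y | δ₁ < d₁ z.1 (g₁ z.2.2) ∨ δ₂ < d₂ z.2.1 (g₂ z.2.2)} with hD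
  set B₁ := {z : S₁ × S₂ × Y | macInfo₁ n p₁ W e₁ e₂ z.1 z.2.1 z.2.2 ≤ R₁ - γ ∧
    z.1 ∈ {s | s ∈ A₁ ∧ d₁ s (g₁ z.2.2) ≤ δ₁}} with hB₁
  set B₂ := {z : S₁ × S₂ × Y | macInfo₂ n p₂ W e₁ e₂ z.1 z.2.1 z.2.2 ≤ R₂ - γ ∧
    z.2.1 ∈ {s | s ∈ A₂ ∧ d₂ s (g₂ z.2.2) ≤ δ₂}} with hB₂
  set B₃ := {z : S₁ × S₂ × Y | macInfo₃ n p₁ p₂ W e₁ e₂ z.1 z.2.1 z.2.2 ≤ R₁ + R₂ - γ ∧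
    z.1 ∈ {s | s ∈ A₁ ∧ d₁ s (g₁ z.2.2) ≤ δ₁} ∧
    z.2.1 ∈ {s | s ∈ A₂ ∧ d₂ s (g₂ z.2.2) ≤ δ₂}} with hB₃
  set C₁ := {z : S₁ × S₂ × Y | z.1 ∈ A₁ᶜ} with hC₁
  set C₂ := {z : S₁ × S₂ × Y | z.2.1 ∈ A₂ᶜ} with hC₂
  have hsub : T ⊆ D ∪ (B₁ ∪ (B₂ ∪ (B₃ ∪ (C₁ ∪ C₂)))) := by
    intro z hz
    simp only [hT, hD, hB₁, hB₂, hB₃, hC₁, hC₂, Set.mem_union, Set.mem_ofPred_eq,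
      Set.mem_compl_iff, ← not_le] at hz ⊢
    tauto
  have hmono := macPr_mono p₁ p₂ W e₁ e₂ hsub
  have hu := macPr_union_le p₁ p₂ W e₁ e₂
  have hu₁ := hu D (B₁ ∪ (B₂ ∪ (B₃ ∪ (C₁ ∪ C₂))))
  have hu₂ := hu B₁ (B₂ ∪ (B₃ ∪ (C₁ ∪ C₂)))
  have hu₃ := hu B₂ (B₃ ∪ (C₁ ∪ C₂))
  have hu₄ := hu B₃ (C₁ ∪ C₂)
  have hu₅ := hu C₁ C₂
  linarith
end
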